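/- (Marr conjecture in one dimension, part (c): failure for algebraic decay) For every natural number n there exist integrable functions f, g : ℝ → ℝ with ∫(1+|x|)^n (|f(x)|+|g(x)|) dx < ∞, such that neither f nor g is almost everywhere a constant multiple of the other, and a strictly increasing sequence (σ_i)_{i≥1} of positive reals with σ_i → ∞, such that for every i the zero set {x ∈ ℝ : (f*M_{σ_i})(x) = 0} equals the zero set {x ∈ ℝ : (g*M_{σ_i})(x) = 0}. -/

import Mathlib

open MeasureTheory Real Filter Topology

noncomputable section

/-- The standard Gaussian `G(x) = (2π)^{-1/2} e^{-x²/2}`. -/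
def gauss (x : ℝ) : ℝ := (Real.sqrt (2 * Real.pi))⁻¹ * Real.exp (-x ^ 2 / 2)

/-- The Ricker (Mexican hat) wavelet `M = G''`, i.e. `M(x) = (x² - 1) G(x)`. -/
def ricker (x : ℝ) : ℝ := (x ^ 2 - 1) * gauss x

/-- The transform `(f * φ_σ)(x)` with `φ_σ(x) = σ⁻¹ φ(x/σ)`. -/
def convScaled1 (f φ : ℝ → ℝ) (σ : ℝ) (x : ℝ) : ℝ :=
  ∫ y, f y * (σ⁻¹ * φ ((x - y) / σ))

/-- A continuous weight of at most quadratic growth. -/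
def QuadGrowth (w : ℝ → ℂ) : Prop :=
  Continuous w ∧ ∃ C, ∀ x, ‖w x‖ ≤ C * (1 + |x|) ^ 2

/-- A continuous kernel of at least quartic decay. -/
def QuartDecay (g : ℝ → ℝ) : Prop :=
  Continuous g ∧ ∃ C, ∀ x, |g x| ≤ C * ((1 + |x|) ^ 4)⁻¹

/-- The convolution of a complex weight with a real kernel. -/
def wconv (w : ℝ → ℂ) (g : ℝ → ℝ) (y : ℝ) : ℂ := ∫ x, w x * (g (y - x) : ℂ)

lemma integrable_inv_one_add_abs_sq (y : ℝ) :
    Integrable (fun x : ℝ => ((1 + |y - x|) ^ 2)⁻¹) := by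
  have h : Integrable (fun x : ℝ => ((1 + |x|) ^ 2)⁻¹) := by
    have := integrable_one_add_norm (E := ℝ) (μ := volume) (r := 2) (by simp)
    refine this.congr (ae_of_all _ fun x => ?_)
    have : (0 : ℝ) < 1 + |x| := by positivity
    simp only [Real.norm_eq_abs]
    rw [Real.rpow_neg this.le]
    norm_cast
  exact h.comp_sub_left y

lemma QuadGrowth.exists_bound {w : ℝ → ℂ} {g : ℝ → ℝ} (hw : QuadGrowth w) (hg : QuartDecay g) :
    ∃ K, 0 ≤ K ∧ ∀ y₀ y x : ℝ, |y - y₀| ≤ 1 →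
      ‖w x * (g (y - x) : ℂ)‖ ≤ K * (1 + |y₀|) ^ 2 * ((1 + |y₀ - x|) ^ 2)⁻¹ := by
  obtain ⟨-, C, hC⟩ := hw
  obtain ⟨-, D, hD⟩ := hg
  have hC0 : 0 ≤ C := by simpa using (norm_nonneg _).trans (hC 0)
  have hD0 : 0 ≤ D := by simpa using (abs_nonneg _).trans (hD 0)
  refine ⟨C * D * 16, by positivity, fun y₀ y x hy => ?_⟩
  have h1 : 1 + |x| ≤ (1 + |y₀|) * (1 + |y₀ - x|) := by
    have : |x| ≤ |y₀| + |y₀ - x| := by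
      have := abs_sub y₀ (y₀ - x)
      simpa using this
    nlinarith [mul_nonneg (abs_nonneg y₀) (abs_nonneg (y₀ - x))]
  have h2 : 1 + |y₀ - x| ≤ 2 * (1 + |y - x|) := by
    have : |y₀ - x| ≤ |y - y₀| + |y - x| := by
      have := abs_sub (y - x) (y - y₀)
      have e : y - x - (y - y₀) = y₀ - x := by ring
      rw [e] at this
      linarith
    linarith [abs_nonneg (y - x)]
  have h3 : (0 : ℝ) < 1 + |y₀ - x| := by positivity
  have h4 : (0 : ℝ) < 1 + |y - x| := by positivity
  rw [norm_mul, Complex.norm_real, Real.norm_eq_abs]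
  calc ‖w x‖ * |g (y - x)| ≤ (C * (1 + |x|) ^ 2) * (D * ((1 + |y - x|) ^ 4)⁻¹) := by
        gcongr
        · exact hC x
        · exact hD _
    _ ≤ (C * ((1 + |y₀|) * (1 + |y₀ - x|)) ^ 2) * (D * (16 * ((1 + |y₀ - x|) ^ 4)⁻¹)) := by
        gcongr
        rw [← div_eq_mul_inv, inv_eq_one_div, div_le_div_iff₀ (by positivity) (by positivity)]
        calc 1 * (1 + |y₀ - x|) ^ 4 ≤ (2 * (1 + |y - x|)) ^ 4 := by
              rw [one_mul]; gcongr
          _ = 16 * (1 + |y - x|) ^ 4 := by ring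
    _ = C * D * 16 * (1 + |y₀|) ^ 2 * ((1 + |y₀ - x|) ^ 2)⁻¹ := by
        field_simp

lemma wconv_integrand_continuous {w : ℝ → ℂ} {g : ℝ → ℝ} (hw : QuadGrowth w) (hg : QuartDecay g)
    (y : ℝ) : Continuous (fun x => w x * (g (y - x) : ℂ)) :=
  hw.1.mul (Complex.continuous_ofReal.comp (hg.1.comp (continuous_const.sub continuous_id)))

lemma wconv_integrable {w : ℝ → ℂ} {g : ℝ → ℝ} (hw : QuadGrowth w) (hg : QuartDecay g) (y : ℝ) :
    Integrable (fun x => w x * (g (y - x) : ℂ)) := by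
  obtain ⟨K, -, hK⟩ := hw.exists_bound hg
  refine ((integrable_inv_one_add_abs_sq y).const_mul (K * (1 + |y|) ^ 2)).mono'
    (wconv_integrand_continuous hw hg y).aestronglyMeasurable (ae_of_all _ fun x => ?_)
  exact hK y y x (by simp)

lemma QuadGrowth.wconv {w : ℝ → ℂ} {g : ℝ → ℝ} (hw : QuadGrowth w) (hg : QuartDecay g) :
    QuadGrowth (wconv w g) := by
  obtain ⟨K, hK0, hK⟩ := hw.exists_bound hg
  constructor
  · rw [continuous_iff_continuousAt]
    intro y₀
    refine continuousAt_of_dominated (bound := fun x => K * (1 + |y₀|) ^ 2 * ((1 + |y₀ - x|) ^ 2)⁻¹)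
      (Eventually.of_forall fun y => (wconv_integrand_continuous hw hg y).aestronglyMeasurable)
      ?_ ((integrable_inv_one_add_abs_sq y₀).const_mul _) (ae_of_all _ fun x => ?_)
    · filter_upwards [Metric.closedBall_mem_nhds y₀ one_pos] with y hy
      exact ae_of_all _ fun x => hK y₀ y x (by simpa [Real.dist_eq] using hy)
    · exact (continuous_const.mul (Complex.continuous_ofReal.comp
        (hg.1.comp (continuous_id.sub continuous_const)))).continuousAt
  · refine ⟨K * ∫ x : ℝ, ((1 + |x|) ^ 2)⁻¹, fun y => ?_⟩
    calc ‖_root_.wconv w g y‖ ≤ ∫ x, K * (1 + |y|) ^ 2 * ((1 + |y - x|) ^ 2)⁻¹ :=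
          norm_integral_le_of_norm_le ((integrable_inv_one_add_abs_sq y).const_mul _)
            (ae_of_all _ fun x => hK y y x (by simp))
      _ = _ := by
          rw [integral_const_mul, integral_sub_left_eq_self (fun x : ℝ => ((1 + |x|) ^ 2)⁻¹)]
          ring

lemma hasDerivAt_wconv {w : ℝ → ℂ} {g g' : ℝ → ℝ} (hw : QuadGrowth w) (hg : QuartDecay g)
    (hg' : QuartDecay g') (hd : ∀ x, HasDerivAt g (g' x) x) (y₀ : ℝ) :
    HasDerivAt (wconv w g) (wconv w g' y₀) y₀ := by
  obtain ⟨K, -, hK⟩ := hw.exists_bound hg'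
  refine (hasDerivAt_integral_of_dominated_loc_of_deriv_le
    (bound := fun x => K * (1 + |y₀|) ^ 2 * ((1 + |y₀ - x|) ^ 2)⁻¹)
    (F' := fun y x => w x * (g' (y - x) : ℂ)) (Metric.closedBall_mem_nhds y₀ one_pos)
    (Eventually.of_forall fun y => (wconv_integrand_continuous hw hg y).aestronglyMeasurable)
    (wconv_integrable hw hg y₀) (wconv_integrand_continuous hw hg' y₀).aestronglyMeasurable
    (ae_of_all _ fun x y hy => hK y₀ y x (by simpa [Real.dist_eq] using hy))
    ((integrable_inv_one_add_abs_sq y₀).const_mul _) (ae_of_all _ fun x y _ => ?_)).2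
  have h : HasDerivAt (fun y => g (y - x)) (g' (y - x)) y := (hd (y - x)).comp_sub_const y x
  exact h.ofReal_comp.const_mul (w x)

lemma wconv_deriv_comm {w w' : ℝ → ℂ} {g g' : ℝ → ℝ} (hw : QuadGrowth w) (hw' : QuadGrowth w')
    (hg : QuartDecay g) (hg' : QuartDecay g') (hdw : ∀ x, HasDerivAt w (w' x) x)
    (hd : ∀ x, HasDerivAt g (g' x) x) (y : ℝ) :
    wconv w' g y = wconv w g' y := by
  have h := integral_mul_deriv_eq_deriv_mul_of_integrable (u := w) (u' := w')
    (v := fun x => (g (y - x) : ℂ)) (v' := fun x => -(g' (y - x) : ℂ)) (fun x _ => hdw x)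
    (fun x _ => ?_) ?_ (wconv_integrable hw' hg y) (wconv_integrable hw hg y)
  · simp only [mul_neg, integral_neg, neg_inj] at h
    exact h.symm
  · have h : HasDerivAt (fun x => g (y - x)) (-g' (y - x)) x := by
      simpa using (hd (y - x)).comp_const_sub y x
    simpa using h.ofReal_comp
  · refine (wconv_integrable hw hg' y).neg.congr (ae_of_all _ fun x => ?_)
    simp

lemma wconv_wconv {w : ℝ → ℂ} {g₁ g₂ : ℝ → ℝ} (hw : QuadGrowth w) (hg₁ : QuartDecay g₁)
    (hg₂ : QuartDecay g₂) (x : ℝ) :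
    wconv (wconv w g₁) g₂ x = wconv w (fun t => ∫ u, g₁ u * g₂ (t - u)) x := by
  have hn : QuadGrowth (fun x => (‖w x‖ : ℂ)) :=
    ⟨Complex.continuous_ofReal.comp hw.1.norm, by simpa using hw.2⟩
  have hn₁ : QuartDecay (fun x => |g₁ x|) := ⟨hg₁.1.abs, by simpa using hg₁.2⟩
  have hc : Continuous (Function.uncurry fun y z : ℝ =>
      w z * (g₁ (y - z) : ℂ) * (g₂ (x - y) : ℂ)) := by
    have := hw.1
    have := hg₁.1
    have := hg₂.1
    simp only [Function.uncurry_def]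
    fun_prop
  have hi : Integrable (Function.uncurry fun y z : ℝ =>
      w z * (g₁ (y - z) : ℂ) * (g₂ (x - y) : ℂ)) (volume.prod volume) := by
    rw [integrable_prod_iff hc.aestronglyMeasurable]
    refine ⟨ae_of_all _ fun y => (wconv_integrable hw hg₁ y).mul_const (g₂ (x - y) : ℂ), ?_⟩
    refine (wconv_integrable (hn.wconv hn₁) hg₂ x).norm.congr (ae_of_all _ fun y => ?_)
    simp only [Function.uncurry_apply_pair, norm_mul, integral_mul_const]
    congr 1
    unfold wconv
    have : ∀ z, ((‖w z‖ : ℂ) * ((|g₁ (y - z)| : ℝ) : ℂ)) = ((‖w z‖ * ‖(g₁ (y - z) : ℂ)‖ : ℝ) : ℂ) := by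
      intro z; simp
    simp_rw [this]
    rw [integral_complex_ofReal, Complex.norm_real, Real.norm_of_nonneg]
    exact integral_nonneg fun z => by positivity
  unfold wconv
  simp_rw [← integral_mul_const]
  rw [integral_integral_swap hi]
  congr 1
  ext z
  simp_rw [mul_assoc]
  rw [integral_const_mul]
  congr 1
  rw [← integral_complex_ofReal,
    ← integral_sub_right_eq_self (fun u => ((g₁ u * g₂ (x - z - u) : ℝ) : ℂ)) z]
  simp

/-- The `k`-th derivative of the standard Gaussian. -/
def gaussDeriv (k : ℕ) : ℝ → ℝ := iteratedDeriv k gauss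

/-- The `k`-th derivative of the Gaussian of standard deviation `σ`. -/
def scaledGaussDeriv (σ : ℝ) (k : ℕ) (x : ℝ) : ℝ := σ⁻¹ ^ (k + 1) * gaussDeriv k (x / σ)

lemma contDiff_gauss : ContDiff ℝ ⊤ gauss := by
  unfold gauss
  fun_prop

lemma gaussDeriv_zero : gaussDeriv 0 = gauss := iteratedDeriv_zero

lemma hasDerivAt_gaussDeriv (k : ℕ) (x : ℝ) :
    HasDerivAt (gaussDeriv k) (gaussDeriv (k + 1) x) x := by
  unfold gaussDeriv
  rw [iteratedDeriv_succ]
  exact (contDiff_gauss.differentiable_iteratedDeriv k (by exact_mod_cast WithTop.coe_lt_top _)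
    x).hasDerivAt

lemma hasDerivAt_gauss (x : ℝ) : HasDerivAt gauss (-x * gauss x) x := by
  have h : HasDerivAt (fun x : ℝ => -x ^ 2 / 2) (-x) x := by
    refine (((hasDerivAt_pow 2 x).neg).div_const 2).congr_deriv ?_
    push_cast
    ring
  refine (h.exp.const_mul (Real.sqrt (2 * Real.pi))⁻¹).congr_deriv ?_
  rw [gauss]
  ring

lemma gaussDeriv_one (x : ℝ) : gaussDeriv 1 x = -x * gauss x :=
  (hasDerivAt_gaussDeriv 0 x).unique (by rw [gaussDeriv_zero]; exact hasDerivAt_gauss x)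

lemma gaussDeriv_add_two (k : ℕ) (x : ℝ) :
    gaussDeriv (k + 2) x = -x * gaussDeriv (k + 1) x - (k + 1) * gaussDeriv k x := by
  induction k generalizing x with
  | zero =>
    refine (hasDerivAt_gaussDeriv 1 x).unique ?_
    have h : gaussDeriv 1 = fun x => -x * gaussDeriv 0 x := by
      ext x; rw [gaussDeriv_one, gaussDeriv_zero]
    rw [h]
    refine ((hasDerivAt_id x).neg.mul (hasDerivAt_gaussDeriv 0 x)).congr_deriv ?_
    simp [gaussDeriv_one, gaussDeriv_zero]
    ring
  | succ k ih =>
    refine (hasDerivAt_gaussDeriv (k + 2) x).unique ?_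
    have h : gaussDeriv (k + 2) =
        fun x => -x * gaussDeriv (k + 1) x - (k + 1) * gaussDeriv k x := funext ih
    rw [h]
    refine (((hasDerivAt_id x).neg.mul (hasDerivAt_gaussDeriv (k + 1) x)).sub
      ((hasDerivAt_gaussDeriv k x).const_mul ((k : ℝ) + 1))).congr_deriv ?_
    simp [ih]
    ring

lemma ricker_eq_gaussDeriv (x : ℝ) : ricker x = gaussDeriv 2 x := by
  rw [gaussDeriv_add_two 0, gaussDeriv_one, gaussDeriv_zero, ricker]
  simp
  ring

lemma gaussDeriv_neg (k : ℕ) (x : ℝ) : gaussDeriv k (-x) = (-1) ^ k * gaussDeriv k x := by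
  induction k using Nat.twoStepInduction generalizing x with
  | zero => simp [gaussDeriv_zero, gauss]
  | one => simp [gaussDeriv_one, gauss]
  | more k h₀ h₁ =>
    rw [gaussDeriv_add_two, gaussDeriv_add_two, h₀, h₁]
    ring

lemma exists_abs_gaussDeriv_mul_pow_le (k m : ℕ) :
    ∃ C, ∀ x, |gaussDeriv k x| * (1 + |x|) ^ m ≤ C := by
  have h₀ : ∀ m, ∃ C, ∀ x, |gaussDeriv 0 x| * (1 + |x|) ^ m ≤ C := by
    intro m
    refine ⟨(Real.sqrt (2 * Real.pi))⁻¹ * (m.factorial * Real.exp (3 / 2)), fun x => ?_⟩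
    rw [gaussDeriv_zero, gauss, abs_mul, abs_of_nonneg (by positivity : 0 ≤ (√(2 * π))⁻¹),
      Real.abs_exp, mul_assoc]
    refine mul_le_mul_of_nonneg_left ?_ (by positivity)
    have h := Real.pow_div_factorial_le_exp (1 + |x|) (by positivity) m
    rw [div_le_iff₀ (by positivity)] at h
    calc rexp (-x ^ 2 / 2) * (1 + |x|) ^ m
        ≤ rexp (-x ^ 2 / 2) * (rexp (1 + |x|) * m.factorial) := by gcongr
      _ = m.factorial * rexp (-x ^ 2 / 2 + (1 + |x|)) := by rw [Real.exp_add (-x ^ 2 / 2)]; ring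
      _ ≤ _ := by
        gcongr
        nlinarith [sq_nonneg (|x| - 1), sq_abs x]
  induction k using Nat.twoStepInduction generalizing m with
  | zero => exact h₀ m
  | one =>
    obtain ⟨C, hC⟩ := h₀ (m + 1)
    refine ⟨C, fun x => le_trans ?_ (hC x)⟩
    rw [gaussDeriv_one, gaussDeriv_zero, abs_mul, abs_neg, pow_succ]
    have : 0 ≤ |gauss x| * (1 + |x|) ^ m := by positivity
    nlinarith
  | more k h₀ h₁ =>
    obtain ⟨C, hC⟩ := h₀ m
    obtain ⟨D, hD⟩ := h₁ (m + 1)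
    refine ⟨D + (k + 1) * C, fun x => ?_⟩
    have h : |gaussDeriv (k + 2) x| ≤ |x| * |gaussDeriv (k + 1) x| + (k + 1) * |gaussDeriv k x| := by
      rw [gaussDeriv_add_two]
      refine (abs_sub _ _).trans (le_of_eq ?_)
      rw [abs_mul, abs_mul, abs_neg, abs_of_nonneg (by positivity : (0 : ℝ) ≤ k + 1)]
    calc |gaussDeriv (k + 2) x| * (1 + |x|) ^ m
        ≤ ((1 + |x|) * |gaussDeriv (k + 1) x| + (k + 1) * |gaussDeriv k x|) * (1 + |x|) ^ m := by
          gcongr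
          refine h.trans ?_
          gcongr
          linarith
      _ = |gaussDeriv (k + 1) x| * (1 + |x|) ^ (m + 1)
          + (k + 1) * (|gaussDeriv k x| * (1 + |x|) ^ m) := by ring
      _ ≤ _ := by
        gcongr
        · exact hD x
        · exact hC x

lemma quartDecay_scaledGaussDeriv {σ : ℝ} (hσ : 0 < σ) (k : ℕ) :
    QuartDecay (scaledGaussDeriv σ k) := by
  constructor
  · have h : Continuous (gaussDeriv k) :=
      continuous_iff_continuousAt.2 fun x => (hasDerivAt_gaussDeriv k x).continuousAt
    exact continuous_const.mul (h.comp (continuous_id.div_const σ))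
  · obtain ⟨C, hC⟩ := exists_abs_gaussDeriv_mul_pow_le k 4
    refine ⟨|σ⁻¹ ^ (k + 1)| * ((1 + σ) ^ 4 * C), fun x => ?_⟩
    rw [scaledGaussDeriv, abs_mul, mul_assoc]
    gcongr
    rw [← div_eq_mul_inv, le_div_iff₀ (by positivity)]
    have h : 1 + |x| ≤ (1 + σ) * (1 + |x / σ|) := by
      rw [abs_div, abs_of_pos hσ]
      have : σ * (|x| / σ) = |x| := by field_simp
      have : 0 ≤ |x| / σ := by positivity
      nlinarith
    calc |gaussDeriv k (x / σ)| * (1 + |x|) ^ 4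
        ≤ |gaussDeriv k (x / σ)| * ((1 + σ) * (1 + |x / σ|)) ^ 4 := by gcongr
      _ = (1 + σ) ^ 4 * (|gaussDeriv k (x / σ)| * (1 + |x / σ|) ^ 4) := by ring
      _ ≤ _ := by gcongr; exact hC _

lemma scaledGaussDeriv_one (k : ℕ) : scaledGaussDeriv 1 k = gaussDeriv k := by
  ext x; simp [scaledGaussDeriv]

lemma quartDecay_gaussDeriv (k : ℕ) : QuartDecay (gaussDeriv k) :=
  scaledGaussDeriv_one k ▸ quartDecay_scaledGaussDeriv one_pos k

lemma hasDerivAt_scaledGaussDeriv (σ : ℝ) (k : ℕ) (x : ℝ) :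
    HasDerivAt (scaledGaussDeriv σ k) (scaledGaussDeriv σ (k + 1) x) x := by
  have h := ((hasDerivAt_gaussDeriv k (x / σ)).comp x
    ((hasDerivAt_id x).div_const σ)).const_mul (σ⁻¹ ^ (k + 1))
  refine h.congr_deriv ?_
  unfold scaledGaussDeriv
  ring

lemma integral_gauss : ∫ x, gauss x = 1 := by
  unfold gauss
  rw [integral_const_mul]
  have h : ∀ x : ℝ, rexp (-x ^ 2 / 2) = rexp (-(1 / 2) * x ^ 2) := fun x => by ring_nf
  simp_rw [h, integral_gaussian]
  rw [show π / (1 / 2) = 2 * π by ring]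
  exact inv_mul_cancel₀ (by positivity)

lemma integral_gauss_mul_scaledGaussDeriv {σ : ℝ} (hσ : 0 < σ) (t : ℝ) :
    ∫ u, gauss u * scaledGaussDeriv σ 0 (t - u) = scaledGaussDeriv √(1 + σ ^ 2) 0 t := by
  have hl : √(1 + σ ^ 2) ^ 2 = 1 + σ ^ 2 := Real.sq_sqrt (by positivity)
  have hl0 : 0 < √(1 + σ ^ 2) := by positivity
  set l := √(1 + σ ^ 2)
  have h : ∀ u, gauss u * scaledGaussDeriv σ 0 (t - u) =
      σ⁻¹ * (√(2 * π))⁻¹ * gauss (t / l) * rexp (-(l ^ 2 / (2 * σ ^ 2)) * (u - t / l ^ 2) ^ 2) := by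
    intro u
    simp only [scaledGaussDeriv, gaussDeriv_zero, gauss, zero_add, pow_one]
    have : rexp (-u ^ 2 / 2) * rexp (-((t - u) / σ) ^ 2 / 2) =
        rexp (-(t / l) ^ 2 / 2) * rexp (-(l ^ 2 / (2 * σ ^ 2)) * (u - t / l ^ 2) ^ 2) := by
      rw [← Real.exp_add, ← Real.exp_add]
      congr 1
      rw [div_pow t l, hl]
      field_simp
      ring
    linear_combination (√(2 * π))⁻¹ ^ 2 * σ⁻¹ * this
  simp_rw [h]
  rw [integral_const_mul, integral_sub_right_eq_self
    (fun u => rexp (-(l ^ 2 / (2 * σ ^ 2)) * u ^ 2)), integral_gaussian,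
    show π / (l ^ 2 / (2 * σ ^ 2)) = (2 * π) * (σ / l) ^ 2 by field_simp,
    Real.sqrt_mul (by positivity) ((σ / l) ^ 2), Real.sqrt_sq (by positivity)]
  simp only [scaledGaussDeriv, gaussDeriv_zero, zero_add, pow_one]
  have : √(2 * π) ≠ 0 := by positivity
  field_simp

/-- The complex power `|x| ^ s` of the absolute value. -/
def absPow (s : ℂ) (x : ℝ) : ℂ := ((|x| : ℝ) : ℂ) ^ s

/-- The `k`-th derivative of the convolution of `|x| ^ s` with the standard Gaussian. -/
def powGauss (s : ℂ) (k : ℕ) : ℝ → ℂ := wconv (absPow s) (gaussDeriv k)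

lemma norm_absPow {s : ℂ} (hs : s.re = 1 / 2) (x : ℝ) : ‖absPow s x‖ = |x| ^ (1 / 2 : ℝ) := by
  rw [absPow, Complex.norm_cpow_eq_rpow_re_of_nonneg (abs_nonneg x) (by rw [hs]; norm_num), hs]

lemma norm_absPow_le {s : ℂ} (hs : s.re = 1 / 2) (x : ℝ) : ‖absPow s x‖ ≤ 1 + |x| := by
  rw [norm_absPow hs]
  calc |x| ^ (1 / 2 : ℝ) ≤ (1 + |x|) ^ (1 / 2 : ℝ) := by gcongr; linarith
    _ ≤ (1 + |x|) ^ (1 : ℝ) := by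
      apply Real.rpow_le_rpow_of_exponent_le _ (by norm_num)
      linarith [abs_nonneg x]
    _ = _ := Real.rpow_one _

lemma continuous_absPow {s : ℂ} (hs : s.re = 1 / 2) : Continuous (absPow s) := by
  have h := Complex.continuous_ofReal_cpow_const (y := s) (by rw [hs]; norm_num)
  exact h.comp continuous_abs

lemma quadGrowth_absPow {s : ℂ} (hs : s.re = 1 / 2) : QuadGrowth (absPow s) :=
  ⟨continuous_absPow hs, 1, fun x => (norm_absPow_le hs x).trans
    (by nlinarith [abs_nonneg x])⟩

lemma quadGrowth_mul_absPow {s : ℂ} (hs : s.re = 1 / 2) :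
    QuadGrowth (fun x => (x : ℂ) * absPow s x) := by
  refine ⟨Complex.continuous_ofReal.mul (continuous_absPow hs), 1, fun x => ?_⟩
  rw [norm_mul, Complex.norm_real, Real.norm_eq_abs]
  have := norm_absPow_le hs x
  nlinarith [abs_nonneg x]

lemma hasDerivAt_mul_absPow {s : ℂ} (hs : s.re = 1 / 2) (x : ℝ) :
    HasDerivAt (fun x : ℝ => (x : ℂ) * absPow s x) ((s + 1) * absPow s x) x := by
  have hs1 : s + 1 ≠ 0 := by
    intro h
    have := congrArg Complex.re h
    rw [Complex.add_re, hs] at this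
    norm_num at this
  have hpos : ∀ y : ℝ, 0 < y →
      HasDerivAt (fun x : ℝ => (x : ℂ) * absPow s x) ((s + 1) * absPow s y) y := by
    intro y hy
    have h := hasDerivAt_ofReal_cpow_const hy.ne' hs1
    rw [add_sub_cancel_right] at h
    have e : absPow s y = (y : ℂ) ^ s := by rw [absPow, abs_of_pos hy]
    rw [e]
    refine h.congr_of_eventuallyEq ?_
    filter_upwards [lt_mem_nhds hy] with z hz
    rw [absPow, abs_of_pos hz, Complex.cpow_add _ _ (by exact_mod_cast hz.ne'), Complex.cpow_one,
      mul_comm]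
  refine hasDerivAt_of_hasDerivAt_of_ne' (g := fun x => (s + 1) * absPow s x) (x := 0) ?_ ?_ ?_ x
  · intro y hy
    rcases hy.lt_or_gt with hy | hy
    · have h := (hpos (-y) (by linarith)).scomp y (hasDerivAt_neg y)
      have h2 := h.neg
      refine (h2.congr_of_eventuallyEq ?_).congr_deriv ?_
      · refine Eventually.of_forall fun z => ?_
        simp [absPow]
      · simp [absPow]
    · exact hpos y hy
  · exact (quadGrowth_mul_absPow hs).1.continuousAt
  · exact (continuous_const.mul (continuous_absPow hs)).continuousAt

lemma hasDerivAt_powGauss {s : ℂ} (hs : s.re = 1 / 2) (k : ℕ) (y : ℝ) :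
    HasDerivAt (powGauss s k) (powGauss s (k + 1) y) y :=
  hasDerivAt_wconv (quadGrowth_absPow hs) (quartDecay_gaussDeriv k)
    (quartDecay_gaussDeriv (k + 1)) (hasDerivAt_gaussDeriv k) y

lemma quadGrowth_powGauss {s : ℂ} (hs : s.re = 1 / 2) (k : ℕ) : QuadGrowth (powGauss s k) :=
  (quadGrowth_absPow hs).wconv (quartDecay_gaussDeriv k)

lemma powGauss_neg (s : ℂ) (k : ℕ) (y : ℝ) :
    powGauss s k (-y) = (-1) ^ k * powGauss s k y := by
  unfold powGauss wconv
  rw [← integral_const_mul, ← integral_neg_eq_self]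
  congr 1
  ext x
  rw [show -y - -x = -(y - x) by ring, gaussDeriv_neg, absPow, abs_neg, ← absPow]
  push_cast
  ring

/-- The Kummer-type equation satisfied by `powGauss s k`. -/
lemma powGauss_add_two {s : ℂ} (hs : s.re = 1 / 2) (k : ℕ) (y : ℝ) :
    powGauss s (k + 2) y + y * powGauss s (k + 1) y = (s - k) * powGauss s k y := by
  have hw := quadGrowth_absPow hs
  have hw' : QuadGrowth (fun x => (s + 1) * absPow s x) := by
    refine ⟨continuous_const.mul hw.1, ?_⟩
    obtain ⟨C, hC⟩ := hw.2
    refine ⟨‖s + 1‖ * C, fun x => ?_⟩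
    rw [norm_mul, mul_assoc]
    gcongr
    exact hC x
  have h := wconv_deriv_comm (quadGrowth_mul_absPow hs) hw' (quartDecay_gaussDeriv k)
    (quartDecay_gaussDeriv (k + 1)) (hasDerivAt_mul_absPow hs) (hasDerivAt_gaussDeriv k) y
  have h1 : wconv (fun x => (s + 1) * absPow s x) (gaussDeriv k) y = (s + 1) * powGauss s k y := by
    unfold powGauss wconv
    rw [← integral_const_mul]
    simp_rw [mul_assoc]
  have hi := wconv_integrable (quadGrowth_mul_absPow hs) (quartDecay_gaussDeriv (k + 1)) y
  have hi0 := wconv_integrable hw (quartDecay_gaussDeriv k) y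
  have hi1 := wconv_integrable hw (quartDecay_gaussDeriv (k + 1)) y
  have h2 : powGauss s (k + 2) y = wconv (fun x => (x : ℂ) * absPow s x) (gaussDeriv (k + 1)) y
      - y * powGauss s (k + 1) y - (k + 1) * powGauss s k y := by
    have hi2 : Integrable fun x : ℝ => (x : ℂ) * absPow s x * (gaussDeriv (k + 1) (y - x) : ℂ) -
        y * (absPow s x * (gaussDeriv (k + 1) (y - x) : ℂ)) := hi.sub (hi1.const_mul _)
    unfold powGauss wconv
    rw [← integral_const_mul, ← integral_const_mul, ← integral_sub hi (hi1.const_mul _),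
      ← integral_sub hi2 (hi0.const_mul _)]
    congr 1
    ext x
    rw [gaussDeriv_add_two]
    push_cast
    ring
  rw [h2, ← h, h1]
  ring

lemma tendsto_powGauss_zero {s : ℂ} (hs : s.re = 1 / 2) :
    Tendsto (fun y : ℝ => powGauss s 0 y * (y : ℂ) ^ (-s)) atTop (𝓝 1) := by
  obtain ⟨hc, C, hC⟩ := quartDecay_gaussDeriv 0
  have hlim : Tendsto (fun y : ℝ => ∫ x, absPow s (1 - x / y) * (gaussDeriv 0 x : ℂ)) atTop
      (𝓝 (∫ x, (gaussDeriv 0 x : ℂ))) := by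
    refine tendsto_integral_filter_of_dominated_convergence (fun x => 2 * C * ((1 + |0 - x|) ^ 2)⁻¹)
      ?_ ?_ ((integrable_inv_one_add_abs_sq 0).const_mul (2 * C)) (ae_of_all _ fun x => ?_)
    · refine Eventually.of_forall fun y => Continuous.aestronglyMeasurable ?_
      exact ((continuous_absPow hs).comp (by fun_prop)).mul (Complex.continuous_ofReal.comp hc)
    · filter_upwards [eventually_ge_atTop 1] with y hy
      refine ae_of_all _ fun x => ?_
      rw [norm_mul, Complex.norm_real, Real.norm_eq_abs, zero_sub, abs_neg]
      have h1 : ‖absPow s (1 - x / y)‖ ≤ 2 * (1 + |x|) ^ 2 := by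
        refine (norm_absPow_le hs _).trans ?_
        have h2 : |1 - x / y| ≤ 1 + |x / y| := (abs_sub _ _).trans (by rw [abs_one])
        have h3 : |x / y| ≤ |x| := by
          rw [abs_div, abs_of_pos (by linarith : (0 : ℝ) < y)]
          exact div_le_self (abs_nonneg x) hy
        nlinarith [abs_nonneg x]
      calc _ ≤ 2 * (1 + |x|) ^ 2 * (C * ((1 + |x|) ^ 4)⁻¹) := by gcongr; exact hC x
        _ = _ := by
          have : (1 + |x|) ≠ 0 := by positivity
          field_simp
    · have h1 : Tendsto (fun y : ℝ => 1 - x / y) atTop (𝓝 (1 - 0)) :=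
        tendsto_const_nhds.sub (tendsto_const_nhds.div_atTop tendsto_id)
      have h2 := ((continuous_absPow hs).tendsto _).comp h1
      have h3 : absPow s (1 - 0) = 1 := by simp [absPow]
      rw [h3] at h2
      simpa using h2.mul_const (gaussDeriv 0 x : ℂ)
  have h1 : ∫ x, (gaussDeriv 0 x : ℂ) = 1 := by
    rw [integral_complex_ofReal, gaussDeriv_zero, integral_gauss, Complex.ofReal_one]
  rw [h1] at hlim
  refine hlim.congr' ?_
  filter_upwards [eventually_gt_atTop 0] with y hy
  unfold powGauss wconv
  rw [← integral_sub_left_eq_self (fun x : ℝ => absPow s x * (gaussDeriv 0 (y - x) : ℂ)) volume y,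
    ← integral_mul_const]
  congr 1
  ext x
  have h2 : absPow s (y - x) = (y : ℂ) ^ s * absPow s (1 - x / y) := by
    have e : |y - x| = y * |1 - x / y| := by
      rw [← abs_of_pos hy, ← abs_mul, abs_of_pos hy]
      congr 1
      field_simp
    rw [absPow, absPow, e, Complex.ofReal_mul, Complex.mul_cpow_ofReal_nonneg hy.le (abs_nonneg _)]
  rw [h2, sub_sub_cancel, Complex.cpow_neg]
  have h3 : (y : ℂ) ^ s ≠ 0 := by
    rw [Complex.cpow_ne_zero_iff]
    left; exact_mod_cast hy.ne'
  field_simp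

lemma exists_norm_powGauss_mul_pow_le {s : ℂ} (hs : s.re = 1 / 2) (k j : ℕ) (hj : j ≤ k) :
    ∃ C, ∀ y : ℝ, 1 ≤ y → ‖powGauss s k y‖ * y ^ j ≤ C * y ^ 2 := by
  induction j generalizing k with
  | zero =>
    obtain ⟨-, C, hC⟩ := quadGrowth_powGauss hs k
    have hC0 : 0 ≤ C := by simpa using (norm_nonneg _).trans (hC 0)
    refine ⟨C * 4, fun y hy => ?_⟩
    rw [pow_zero, mul_one]
    refine (hC y).trans ?_
    rw [abs_of_pos (by linarith), mul_assoc]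
    gcongr
    nlinarith
  | succ j ih =>
    obtain ⟨k, rfl⟩ := Nat.exists_eq_succ_of_ne_zero (by omega : k ≠ 0)
    obtain ⟨C, hC⟩ := ih k (by omega)
    obtain ⟨D, hD⟩ := ih (k + 2) (by omega)
    refine ⟨‖s - k‖ * C + D, fun y hy => ?_⟩
    have hy0 : 0 < y := by linarith
    have h : (y : ℂ) * powGauss s (k + 1) y = (s - k) * powGauss s k y - powGauss s (k + 2) y := by
      rw [← powGauss_add_two hs]; ring
    have h' := congrArg norm h
    rw [norm_mul, Complex.norm_real, Real.norm_of_nonneg hy0.le] at h'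
    calc ‖powGauss s (k + 1) y‖ * y ^ (j + 1) = (y * ‖powGauss s (k + 1) y‖) * y ^ j := by ring
      _ ≤ (‖s - k‖ * ‖powGauss s k y‖ + ‖powGauss s (k + 2) y‖) * y ^ j := by
        rw [h']
        gcongr
        exact (norm_sub_le _ _).trans (by rw [norm_mul])
      _ = ‖s - k‖ * (‖powGauss s k y‖ * y ^ j) + ‖powGauss s (k + 2) y‖ * y ^ j := by ring
      _ ≤ ‖s - k‖ * (C * y ^ 2) + D * y ^ 2 := by
        exact add_le_add (mul_le_mul_of_nonneg_left (hC y hy) (norm_nonneg _)) (hD y hy)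
      _ = _ := by ring

lemma tendsto_powGauss {s : ℂ} (hs : s.re = 1 / 2) (k : ℕ) :
    Tendsto (fun y : ℝ => powGauss s k y * (y : ℂ) ^ ((k : ℂ) - s)) atTop
      (𝓝 (∏ j ∈ Finset.range k, (s - j))) := by
  induction k with
  | zero => simpa using tendsto_powGauss_zero hs
  | succ k ih =>
    obtain ⟨C, hC⟩ := exists_norm_powGauss_mul_pow_le hs (k + 2) (k + 2) le_rfl
    have h0 : Tendsto (fun y : ℝ => powGauss s (k + 2) y * (y : ℂ) ^ ((k : ℂ) - s)) atTop (𝓝 0) := by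
      refine squeeze_zero_norm' ?_ (a := fun y : ℝ => C * y ^ (-(1 / 2 : ℝ))) ?_
      · filter_upwards [eventually_ge_atTop 1] with y hy
        have hy0 : 0 < y := by linarith
        rw [norm_mul, Complex.norm_cpow_eq_rpow_re_of_pos hy0, Complex.sub_re, hs,
          Complex.natCast_re]
        have h1 := hC y hy
        have h2 : y ^ ((k : ℝ) - 1 / 2) = y ^ (k + 2) * (y ^ 2)⁻¹ * y ^ (-(1 / 2 : ℝ)) := by
          rw [sub_eq_add_neg, Real.rpow_add hy0, Real.rpow_natCast]
          field_simp
          ring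
        calc _ = (‖powGauss s (k + 2) y‖ * y ^ (k + 2)) * ((y ^ 2)⁻¹ * y ^ (-(1 / 2 : ℝ))) := by
              rw [h2]; ring
          _ ≤ (C * y ^ 2) * ((y ^ 2)⁻¹ * y ^ (-(1 / 2 : ℝ))) := by gcongr
          _ = _ := by field_simp
      · simpa using (tendsto_rpow_neg_atTop (by norm_num : (0 : ℝ) < 1 / 2)).const_mul C
    have h := (ih.const_mul (s - k)).sub h0
    rw [sub_zero, mul_comm, ← Finset.prod_range_succ] at h
    refine h.congr' ?_
    filter_upwards [eventually_gt_atTop 0] with y hy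
    have hy0 : (y : ℂ) ≠ 0 := by exact_mod_cast hy.ne'
    have e : ((k + 1 : ℕ) : ℂ) - s = 1 + ((k : ℂ) - s) := by push_cast; ring
    rw [e, Complex.cpow_add _ _ hy0, Complex.cpow_one]
    linear_combination -((y : ℂ) ^ ((k : ℂ) - s)) * powGauss_add_two hs k y

lemma prod_sub_natCast_ne_zero {s : ℂ} (hs : s.re = 1 / 2) (k : ℕ) :
    ∏ j ∈ Finset.range k, (s - j) ≠ 0 := by
  refine Finset.prod_ne_zero_iff.2 fun j _ h => ?_
  have h1 := congrArg Complex.re h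
  rw [Complex.sub_re, hs, Complex.natCast_re, Complex.zero_re] at h1
  have h2 : (2 * j : ℝ) = 1 := by linarith
  have h3 : 2 * j = 1 := by exact_mod_cast h2
  omega

lemma powGauss_isTheta_atTop {s : ℂ} (hs : s.re = 1 / 2) (k : ℕ) :
    powGauss s k =Θ[atTop] fun y : ℝ => y ^ (1 / 2 - k : ℝ) := by
  set P := ∏ j ∈ Finset.range k, (s - j)
  have hP : 0 < ‖P‖ := norm_pos_iff.2 (prod_sub_natCast_ne_zero hs k)
  have h := (tendsto_powGauss hs k).norm
  have key : ∀ y : ℝ, 0 < y → ‖powGauss s k y‖ =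
      ‖powGauss s k y * (y : ℂ) ^ ((k : ℂ) - s)‖ * ‖y ^ (1 / 2 - k : ℝ)‖ := by
    intro y hy
    rw [norm_mul, Complex.norm_cpow_eq_rpow_re_of_pos hy, Complex.sub_re, hs,
      Complex.natCast_re, Real.norm_of_nonneg (Real.rpow_nonneg hy.le _), mul_assoc,
      ← Real.rpow_add hy]
    simp
  constructor
  · refine Asymptotics.IsBigO.of_bound (‖P‖ * 2) ?_
    filter_upwards [eventually_gt_atTop 0, h.eventually_le_const (by linarith : ‖P‖ < ‖P‖ * 2)]
      with y hy h1
    rw [key y hy]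
    gcongr
  · refine Asymptotics.IsBigO.of_bound (‖P‖ / 2)⁻¹ ?_
    filter_upwards [eventually_gt_atTop 0, h.eventually_const_le (by linarith : ‖P‖ / 2 < ‖P‖)]
      with y hy h1
    rw [key y hy, ← div_eq_inv_mul, le_div_iff₀ (by linarith), mul_comm]
    gcongr

lemma powGauss_isTheta_cocompact {s : ℂ} (hs : s.re = 1 / 2) (k : ℕ) :
    powGauss s k =Θ[cocompact ℝ] fun y : ℝ => |y| ^ (1 / 2 - k : ℝ) := by
  have h : powGauss s k =Θ[atTop] fun y : ℝ => |y| ^ (1 / 2 - k : ℝ) := by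
    refine (powGauss_isTheta_atTop hs k).trans_eventuallyEq ?_
    filter_upwards [eventually_ge_atTop 0] with y hy
    rw [abs_of_nonneg hy]
  have hb : powGauss s k =Θ[atBot] fun y : ℝ => |y| ^ (1 / 2 - k : ℝ) := by
    have h1 : (powGauss s k ∘ Neg.neg) =Θ[atBot]
        ((fun y : ℝ => |y| ^ (1 / 2 - k : ℝ)) ∘ Neg.neg) :=
      ⟨h.1.comp_tendsto tendsto_neg_atBot_atTop, h.2.comp_tendsto tendsto_neg_atBot_atTop⟩
    have h2 : (fun y => ‖powGauss s k y‖) = fun y => ‖(powGauss s k ∘ Neg.neg) y‖ := by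
      ext y
      simp [powGauss_neg]
    have h3 : ((fun y : ℝ => |y| ^ (1 / 2 - k : ℝ)) ∘ Neg.neg) =
        fun y : ℝ => |y| ^ (1 / 2 - k : ℝ) := by
      ext y
      simp
    rw [h3] at h1
    rw [← Asymptotics.isTheta_norm_left, h2, Asymptotics.isTheta_norm_left]
    exact h1
  rw [cocompact_eq_atBot_atTop]
  exact hb.sup h

lemma eventually_cocompact_powGauss_ne_zero {s : ℂ} (hs : s.re = 1 / 2) (k : ℕ) :
    ∀ᶠ y in cocompact ℝ, powGauss s k y ≠ 0 := by
  filter_upwards [(powGauss_isTheta_cocompact hs k).eq_zero_iff,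
    (isCompact_singleton (x := (0 : ℝ))).compl_mem_cocompact] with y hy h0
  rw [Ne, hy]
  exact (Real.rpow_pos_of_pos (abs_pos.2 h0) _).ne'

lemma exists_powGauss_ne_zero {s : ℂ} (hs : s.re = 1 / 2) (k : ℕ) : ∃ y, powGauss s k y ≠ 0 :=
  (eventually_cocompact_powGauss_ne_zero hs k).exists

lemma integrable_moment_powGauss {s : ℂ} (hs : s.re = 1 / 2) (n : ℕ) :
    Integrable fun y : ℝ => (1 + |y|) ^ n * ‖powGauss s (n + 2) y‖ := by
  have hc : Continuous fun y : ℝ => (1 + |y|) ^ n * ‖powGauss s (n + 2) y‖ := by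
    have := (quadGrowth_powGauss hs (n + 2)).1
    fun_prop
  refine hc.locallyIntegrable.integrable_of_isBigO_cocompact
    (g := fun y => (1 + ‖y‖) ^ (-(3 / 2 : ℝ)))
    ?_ ((integrable_one_add_norm (by norm_num)).integrableAtFilter _)
  obtain ⟨C, hC0, hC⟩ := (powGauss_isTheta_cocompact hs (n + 2)).1.exists_pos
  refine Asymptotics.IsBigO.of_bound (2 ^ n * C * 2 ^ (3 / 2 : ℝ)) ?_
  filter_upwards [hC.bound, (isCompact_closedBall (0 : ℝ) 1).compl_mem_cocompact] with y hy h1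
  have h1 : 1 < |y| := by simpa using h1
  have hy0 : 0 < |y| := by linarith
  rw [Real.norm_of_nonneg (by positivity)] at hy
  have h0 : 0 ≤ (1 + |y|) ^ (-(3 / 2 : ℝ)) := by positivity
  rw [Real.norm_of_nonneg (by positivity), Real.norm_eq_abs y, Real.norm_of_nonneg h0]
  have h2 : |y| ^ (-(3 / 2) : ℝ) ≤ ((1 + |y|) / 2) ^ (-(3 / 2) : ℝ) :=
    Real.rpow_le_rpow_of_nonpos (by positivity) (by linarith) (by norm_num)
  have h3 : ((1 + |y|) / 2) ^ (-(3 / 2) : ℝ) = 2 ^ (3 / 2 : ℝ) * (1 + |y|) ^ (-(3 / 2) : ℝ) := by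
    rw [Real.div_rpow (by positivity) (by norm_num), Real.rpow_neg (by norm_num : (0 : ℝ) ≤ 2)]
    field_simp
  have h4 : |y| ^ n * |y| ^ (1 / 2 - (n + 2 : ℕ) : ℝ) = |y| ^ (-(3 / 2) : ℝ) := by
    rw [← Real.rpow_natCast, ← Real.rpow_add hy0]
    congr 1
    push_cast
    ring
  calc (1 + |y|) ^ n * ‖powGauss s (n + 2) y‖
      ≤ (2 * |y|) ^ n * (C * |y| ^ (1 / 2 - (n + 2 : ℕ) : ℝ)) := by
        gcongr
        linarith
    _ = 2 ^ n * C * |y| ^ (-(3 / 2) : ℝ) := by rw [← h4]; ring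
    _ ≤ 2 ^ n * C * (2 ^ (3 / 2 : ℝ) * (1 + |y|) ^ (-(3 / 2) : ℝ)) := by
        rw [← h3]
        gcongr
    _ = _ := by ring

/-- Local and cocompact domination combine to global domination. -/
lemma exists_norm_le_of_isBigO {H E : ℝ → ℂ} (hloc : ∀ z, H =O[𝓝 z] E)
    (hinf : H =O[cocompact ℝ] E) : ∃ C, ∀ y, ‖H y‖ ≤ C * ‖E y‖ := by
  obtain ⟨C, hC⟩ := hinf.bound
  obtain ⟨K, hK, hKC⟩ := mem_cocompact.1 hC
  have h : ∃ D, ∀ y ∈ K, ‖H y‖ ≤ D * ‖E y‖ := by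
    refine hK.induction_on (p := fun S => ∃ D, ∀ y ∈ S, ‖H y‖ ≤ D * ‖E y‖) (by simp) ?_ ?_ ?_
    · rintro S T hST ⟨D, hD⟩
      exact ⟨D, fun y hy => hD y (hST hy)⟩
    · rintro S T ⟨D, hD⟩ ⟨D', hD'⟩
      refine ⟨max D D', fun y hy => ?_⟩
      rcases hy with hy | hy
      · exact (hD y hy).trans (by gcongr; exact le_max_left _ _)
      · exact (hD' y hy).trans (by gcongr; exact le_max_right _ _)
    · intro z _
      obtain ⟨D, hD⟩ := (hloc z).bound
      exact ⟨_, mem_nhdsWithin_of_mem_nhds hD, D, fun y hy => hy⟩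
  obtain ⟨D, hD⟩ := h
  refine ⟨max C D, fun y => ?_⟩
  by_cases hy : y ∈ K
  · exact (hD y hy).trans (by gcongr; exact le_max_right _ _)
  · exact (hKC hy).trans (by gcongr; exact le_max_left _ _)

/-- The zeros of `powGauss s k` are simple. -/
lemma powGauss_succ_ne_zero {s : ℂ} (hs : s.re = 1 / 2) {k : ℕ} {z : ℝ}
    (hz : powGauss s k z = 0) : powGauss s (k + 1) z ≠ 0 := by
  intro hz'
  obtain ⟨y, hy⟩ := exists_powGauss_ne_zero hs k
  refine hy ?_
  set R := |z| + |y| + 1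
  have hR : 0 < R := by positivity
  let v : ℝ → ℂ × ℂ → ℂ × ℂ := fun t p => (p.2, (s - k) * p.1 - t * p.2)
  have hv : ∀ t ∈ Set.Ioo (-R) R,
      LipschitzOnWith (1 + ‖s - k‖₊ + R.toNNReal) (v t) Set.univ := by
    intro t ht
    refine (LipschitzWith.of_dist_le_mul fun p q => ?_).lipschitzOnWith
    have h1 : ‖p.1 - q.1‖ ≤ ‖p - q‖ := norm_fst_le (p - q)
    have h2 : ‖p.2 - q.2‖ ≤ ‖p - q‖ := norm_snd_le (p - q)
    have ht' : |t| ≤ R := (abs_lt.2 ht).le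
    have h3 : ‖(v t p).2 - (v t q).2‖ ≤ ‖s - k‖ * ‖p - q‖ + R * ‖p - q‖ := by
      have e : (v t p).2 - (v t q).2 = (s - k) * (p.1 - q.1) - t * (p.2 - q.2) := by
        simp only [v]; ring
      rw [e]
      refine (norm_sub_le _ _).trans ?_
      rw [norm_mul, norm_mul, Complex.norm_real, Real.norm_eq_abs]
      gcongr
    rw [dist_eq_norm, dist_eq_norm, Prod.norm_def]
    push_cast
    rw [Real.coe_toNNReal _ hR.le]
    have h0 := norm_nonneg (p - q)
    refine max_le ?_ ?_
    · refine h2.trans ?_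
      nlinarith [norm_nonneg (s - k), mul_nonneg (norm_nonneg (s - k)) h0, mul_nonneg hR.le h0]
    · refine h3.trans ?_
      nlinarith
  have hmem : ∀ x, |x| < R → x ∈ Set.Ioo (-R) R := fun x hx => abs_lt.1 hx
  have huniq := ODE_solution_unique_of_mem_Ioo (v := v) (s := fun _ => Set.univ)
    (f := fun t => (powGauss s k t, powGauss s (k + 1) t)) (g := fun _ => 0) hv
    (hmem z (by simp only [R]; linarith [abs_nonneg y])) (fun t _ => ⟨?_, trivial⟩)
    (fun t _ => ⟨?_, trivial⟩) (by simp [hz, hz'])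
  · have := huniq (hmem y (by simp only [R]; linarith [abs_nonneg z]))
    exact congrArg Prod.fst this
  · refine ((hasDerivAt_powGauss hs k t).prodMk (hasDerivAt_powGauss hs (k + 1) t)).congr_deriv ?_
    simp only [v]
    rw [← powGauss_add_two hs]
    congr 1
    ring
  · refine (hasDerivAt_const t (0 : ℂ × ℂ)).congr_deriv ?_
    simp only [v, Prod.fst_zero, Prod.snd_zero, mul_zero, sub_zero]
    rfl

lemma finite_setOf_powGauss_eq_zero {s : ℂ} (hs : s.re = 1 / 2) (k : ℕ) :
    {z | powGauss s k z = 0}.Finite := by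
  by_contra hinf
  obtain ⟨K, hK, hKs⟩ := mem_cocompact.1 (eventually_cocompact_powGauss_ne_zero hs k)
  obtain ⟨z, -, hz⟩ := Set.Infinite.exists_accPt_of_subset_isCompact hinf hK
    (fun x hx => by_contra fun hxK => hKs hxK hx)
  rw [accPt_iff_frequently_nhdsNE] at hz
  have hz0 : powGauss s k z = 0 := by
    by_contra h
    have := (quadGrowth_powGauss hs k).1.continuousAt.eventually_ne h
    exact hz ((this.filter_mono nhdsWithin_le_nhds))
  exact hz ((hasDerivAt_powGauss hs k z).eventually_ne (powGauss_succ_ne_zero hs hz0))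

lemma isBigO_nhds_powGauss {s : ℂ} (hs : s.re = 1 / 2) (k : ℕ) {H H' : ℝ → ℂ}
    (hH : ∀ y, HasDerivAt H (H' y) y) (hz : ∀ z, powGauss s k z = 0 → H z = 0) (z : ℝ) :
    H =O[𝓝 z] powGauss s k := by
  by_cases h : powGauss s k z = 0
  · have h1 := (hH z).isBigO_sub
    have h2 : (fun x => x - z) =O[𝓝 z] fun x => powGauss s k x - powGauss s k z := by
      have h3 := ((hasDerivAt_powGauss hs k z).isTheta_sub (powGauss_succ_ne_zero hs h)).2
      rw [prod_pure] at h3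
      exact Asymptotics.isBigO_map.1 h3
    simpa [hz z h, h] using h1.trans h2
  · have h1 : H =O[𝓝 z] fun _ => (1 : ℝ) := (hH z).continuousAt.tendsto.isBigO_one ℝ
    have h2 := (quadGrowth_powGauss hs k).1.continuousAt.tendsto (x := z)
    refine h1.trans ?_
    refine Asymptotics.IsBigO.of_bound (‖powGauss s k z‖ / 2)⁻¹ ?_
    have h0 := norm_pos_iff.2 h
    filter_upwards [h2.norm.eventually_const_le (by linarith : ‖powGauss s k z‖ / 2 < _)] with y hy
    rw [← div_eq_inv_mul, le_div_iff₀ (by linarith)]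
    simpa using hy

lemma linearIndependent_powGauss {ι : Type*} {s : ι → ℂ} (hinj : Function.Injective s)
    (hs : ∀ i, (s i).re = 1 / 2) (N : ℕ) : LinearIndependent ℂ fun i => powGauss (s i) N := by
  let T : Module.End ℂ (ℕ → ℝ → ℂ) :=
    { toFun := fun u j y => u (j + 2) y + y * u (j + 1) y + (N + j) * u j y
      map_add' := fun u v => by ext j y; simp only [Pi.add_apply]; ring
      map_smul' := fun a u => by
        ext j y; simp only [Pi.smul_apply, smul_eq_mul, RingHom.id_apply]; ring }
  have hT : ∀ i, T.HasEigenvector (s i) (fun j => powGauss (s i) (N + j)) := by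
    intro i
    rw [Module.End.hasEigenvector_iff, Module.End.mem_eigenspace_iff]
    constructor
    · ext j y
      simp only [T, LinearMap.coe_mk, AddHom.coe_mk, Pi.smul_apply, smul_eq_mul]
      have := powGauss_add_two (hs i) (N + j) y
      push_cast at this
      rw [← add_assoc, ← add_assoc, this]
      ring
    · intro h
      obtain ⟨y, hy⟩ := exists_powGauss_ne_zero (hs i) N
      exact hy (congrFun (congrFun h 0) y)
  have hv := Module.End.eigenvectors_linearIndependent' T s hinj _ hT
  rw [linearIndependent_iff'] at hv ⊢
  intro S c hc
  refine hv S c ?_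
  have key : ∀ j y, ∑ i ∈ S, c i * powGauss (s i) (N + j) y = 0 := by
    intro j
    induction j with
    | zero => intro y; simpa using congrFun hc y
    | succ j ih =>
      intro y
      have h1 : HasDerivAt (fun y => ∑ i ∈ S, c i * powGauss (s i) (N + j) y)
          (∑ i ∈ S, c i * powGauss (s i) (N + j + 1) y) y :=
        HasDerivAt.fun_sum fun i _ => (hasDerivAt_powGauss (hs i) (N + j) y).const_mul (c i)
      rw [funext ih] at h1
      exact h1.unique (hasDerivAt_const y 0)
  ext j y
  simpa using key j y

/-- Exponents with real part `1 / 2` on which every dilation by a power of `e` acts alike. -/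
def powFreq (k : ℕ) : ℂ := 1 / 2 + k * (2 * π * Complex.I)

lemma powFreq_re (k : ℕ) : (powFreq k).re = 1 / 2 := by
  simp [powFreq]

lemma powFreq_zero : powFreq 0 = 1 / 2 := by
  simp [powFreq]

lemma powFreq_injective : Function.Injective powFreq := by
  intro a b h
  have h1 : (a : ℂ) * (2 * π * Complex.I) = b * (2 * π * Complex.I) := add_left_cancel h
  exact_mod_cast mul_right_cancel₀ Complex.two_pi_I_ne_zero h1

/-- Finite combinations of the functions `powGauss (powFreq j) k`. -/
def powGaussSum {m : ℕ} (d : Fin m → ℂ) (k : ℕ) (y : ℝ) : ℂ :=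
  ∑ j, d j * powGauss (powFreq j) k y

lemma powGaussSum_add {m : ℕ} (d e : Fin m → ℂ) (k : ℕ) (y : ℝ) :
    powGaussSum (d + e) k y = powGaussSum d k y + powGaussSum e k y := by
  simp [powGaussSum, add_mul, Finset.sum_add_distrib]

lemma powGaussSum_smul {m : ℕ} (a : ℂ) (d : Fin m → ℂ) (k : ℕ) (y : ℝ) :
    powGaussSum (a • d) k y = a * powGaussSum d k y := by
  simp [powGaussSum, Finset.mul_sum, mul_assoc]

lemma powGaussSum_single {m : ℕ} (k : ℕ) (y : ℝ) :
    powGaussSum (Pi.single 0 1 : Fin (m + 1) → ℂ) k y = powGauss (1 / 2) k y := by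
  rw [powGaussSum, Finset.sum_eq_single 0 (fun j _ hj => by simp [hj]) (by simp)]
  simp [powFreq_zero]

lemma hasDerivAt_powGaussSum {m : ℕ} (d : Fin m → ℂ) (k : ℕ) (y : ℝ) :
    HasDerivAt (powGaussSum d k) (powGaussSum d (k + 1) y) y :=
  HasDerivAt.fun_sum fun j _ => (hasDerivAt_powGauss (powFreq_re j) k y).const_mul (d j)

lemma continuous_powGaussSum {m : ℕ} (d : Fin m → ℂ) (k : ℕ) : Continuous (powGaussSum d k) :=
  continuous_iff_continuousAt.2 fun y => (hasDerivAt_powGaussSum d k y).continuousAt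

lemma powGaussSum_eq_zero {m : ℕ} {d : Fin m → ℂ} {k : ℕ} (h : ∀ y, powGaussSum d k y = 0) :
    d = 0 := by
  have hi := linearIndependent_powGauss (s := fun j : Fin m => powFreq j)
    (powFreq_injective.comp Fin.val_injective) (fun j => powFreq_re j) k
  rw [Fintype.linearIndependent_iff] at hi
  ext j
  refine hi d ?_ j
  ext y
  simpa [powGaussSum] using h y

lemma integrable_moment_powGaussSum {m : ℕ} (d : Fin m → ℂ) (n : ℕ) :
    Integrable fun y : ℝ => (1 + |y|) ^ n * ‖powGaussSum d (n + 2) y‖ := by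
  have h : Integrable fun y : ℝ =>
      ∑ j, ‖d j‖ * ((1 + |y|) ^ n * ‖powGauss (powFreq j) (n + 2) y‖) :=
    integrable_finsetSum _ fun j _ =>
      (integrable_moment_powGauss (powFreq_re j) n).const_mul _
  refine h.mono' ?_ (ae_of_all _ fun y => ?_)
  · have := continuous_powGaussSum d (n + 2)
    exact Continuous.aestronglyMeasurable (by fun_prop)
  · rw [Real.norm_of_nonneg (by positivity)]
    calc _ ≤ (1 + |y|) ^ n * ∑ j, ‖d j * powGauss (powFreq j) (n + 2) y‖ := by
          gcongr
          exact norm_sum_le _ _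
      _ = _ := by
          rw [Finset.mul_sum]
          refine Finset.sum_congr rfl fun j _ => ?_
          rw [norm_mul]
          ring

lemma powGauss_half_eq_re (k : ℕ) (y : ℝ) :
    powGauss (1 / 2) k y = ((powGauss (1 / 2) k y).re : ℂ) := by
  have h : powGauss (1 / 2) k y = ((∫ x, |x| ^ (1 / 2 : ℝ) * gaussDeriv k (y - x) : ℝ) : ℂ) := by
    unfold powGauss wconv
    rw [← integral_complex_ofReal]
    congr 1
    ext x
    rw [Complex.ofReal_mul, Complex.ofReal_cpow (abs_nonneg x), absPow]
    norm_num
  rw [h, Complex.ofReal_re]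

/-- A combination dominated by `powGauss (1 / 2) M` whose analogue of order `N` has real part not
proportional to that of `powGauss (1 / 2) N`. -/
lemma exists_powGaussSum_dominated (N M : ℕ) :
    ∃ (m : ℕ) (c : Fin (m + 1) → ℂ),
      (∃ C, ∀ y, ‖powGaussSum c M y‖ ≤ C * ‖powGauss (1 / 2) M y‖) ∧
      ¬ ∃ a : ℝ, ∀ y, (powGaussSum c N y).re = a * (powGauss (1 / 2) N y).re := by
  have hs : (1 / 2 : ℂ).re = 1 / 2 := by norm_num
  have hfin := finite_setOf_powGauss_eq_zero hs M
  set Z := {z | powGauss (1 / 2) M z = 0}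
  have : Fintype Z := hfin.fintype
  let m := Fintype.card Z + 1
  let L : (Fin (m + 1) → ℂ) →ₗ[ℂ] (Z → ℂ) × ℂ :=
    { toFun := fun c => (fun z => powGaussSum c M z, c 0)
      map_add' := fun c d => by
        ext <;> simp [powGaussSum_add]
      map_smul' := fun a c => by
        ext <;> simp [powGaussSum_smul] }
  obtain ⟨c, hcL, hc⟩ := Submodule.exists_mem_ne_zero_of_ne_bot
    (LinearMap.ker_ne_bot_of_finrank_lt (f := L) (by simp [m]))
  have hcL' : L c = 0 := hcL
  have hc0 : c 0 = 0 := congrArg Prod.snd hcL'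
  have hcZ : ∀ z, powGauss (1 / 2) M z = 0 → powGaussSum c M z = 0 := fun z hz =>
    congrFun (congrArg Prod.fst hcL') ⟨z, hz⟩
  have hinf : powGaussSum c M =O[cocompact ℝ] powGauss (1 / 2) M := by
    refine Asymptotics.IsBigO.fun_sum fun j _ => Asymptotics.IsBigO.const_mul_left ?_ _
    exact (powGauss_isTheta_cocompact (powFreq_re j) M).1.trans
      (powGauss_isTheta_cocompact hs M).2
  obtain ⟨C, hC⟩ := exists_norm_le_of_isBigO
    (isBigO_nhds_powGauss hs M (hasDerivAt_powGaussSum c M) hcZ) hinf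
  have hnot : ¬ ∃ a : ℂ, ∀ y, powGaussSum c N y = a * powGauss (1 / 2) N y := by
    rintro ⟨a, ha⟩
    have h := powGaussSum_eq_zero (d := c + (-a) • Pi.single 0 1) (k := N) (fun y => by
      rw [powGaussSum_add, powGaussSum_smul, powGaussSum_single, ha]; ring)
    have h0 := congrFun h 0
    simp [hc0] at h0
    simp [h0] at h
    exact hc h
  by_cases h1 : ∃ a : ℝ, ∀ y, (powGaussSum c N y).re = a * (powGauss (1 / 2) N y).re
  · refine ⟨m, (-Complex.I) • c, ⟨C, fun y => ?_⟩, ?_⟩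
    · rw [powGaussSum_smul, norm_mul, norm_neg, Complex.norm_I, one_mul]
      exact hC y
    · rintro ⟨b, hb⟩
      obtain ⟨a, ha⟩ := h1
      refine hnot ⟨a + b * Complex.I, fun y => ?_⟩
      have hb' := hb y
      rw [powGaussSum_smul] at hb'
      simp only [Complex.mul_re, Complex.neg_re, Complex.I_re, Complex.neg_im, Complex.I_im] at hb'
      rw [powGauss_half_eq_re]
      apply Complex.ext
      · simp [ha y]
      · simp only [Complex.mul_im, Complex.add_re, Complex.add_im, Complex.ofReal_re,
          Complex.ofReal_im, Complex.mul_re, Complex.I_re, Complex.I_im]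
        linarith
  · exact ⟨m, c, ⟨C, hC⟩, h1⟩

lemma wconv_powGauss_scaledGaussDeriv {s : ℂ} (hs : s.re = 1 / 2) {σ : ℝ} (hσ : 0 < σ)
    (k j : ℕ) : wconv (powGauss s k) (scaledGaussDeriv σ j) =
      wconv (absPow s) (scaledGaussDeriv √(1 + σ ^ 2) (k + j)) := by
  have hl : 0 < √(1 + σ ^ 2) := by positivity
  induction k generalizing j with
  | zero =>
    induction j with
    | zero =>
      ext x
      rw [powGauss, wconv_wconv (quadGrowth_absPow hs) (quartDecay_gaussDeriv 0)
        (quartDecay_scaledGaussDeriv hσ 0), gaussDeriv_zero]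
      congr 1
      ext t
      exact integral_gauss_mul_scaledGaussDeriv hσ t
    | succ j ih =>
      ext x
      have h1 := hasDerivAt_wconv (quadGrowth_powGauss hs 0) (quartDecay_scaledGaussDeriv hσ j)
        (quartDecay_scaledGaussDeriv hσ (j + 1)) (hasDerivAt_scaledGaussDeriv σ j) x
      have h2 := hasDerivAt_wconv (quadGrowth_absPow hs) (quartDecay_scaledGaussDeriv hl (0 + j))
        (quartDecay_scaledGaussDeriv hl (0 + j + 1)) (hasDerivAt_scaledGaussDeriv _ (0 + j)) x
      rw [ih] at h1
      exact h1.unique h2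
  | succ k ih =>
    have h : wconv (powGauss s (k + 1)) (scaledGaussDeriv σ j) =
        wconv (powGauss s k) (scaledGaussDeriv σ (j + 1)) :=
      funext fun x => wconv_deriv_comm (quadGrowth_powGauss hs k) (quadGrowth_powGauss hs (k + 1))
        (quartDecay_scaledGaussDeriv hσ j) (quartDecay_scaledGaussDeriv hσ (j + 1))
        (hasDerivAt_powGauss hs k) (hasDerivAt_scaledGaussDeriv σ j) x
    rw [h, ih, add_right_comm, add_assoc]

lemma wconv_absPow_scaledGaussDeriv (s : ℂ) {l : ℝ} (hl : 0 < l) (k : ℕ) (x : ℝ) :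
    wconv (absPow s) (scaledGaussDeriv l k) x =
      (l : ℂ) ^ s * (l⁻¹ : ℂ) ^ k * powGauss s k (x / l) := by
  have h := Measure.integral_comp_mul_left
    (fun u : ℝ => absPow s u * (scaledGaussDeriv l k (x - u) : ℂ)) l
  rw [abs_of_pos (inv_pos.2 hl), Complex.real_smul] at h
  have hl' : (l : ℂ) ≠ 0 := by exact_mod_cast hl.ne'
  have h1 : wconv (absPow s) (scaledGaussDeriv l k) x =
      l * ∫ u : ℝ, absPow s (l * u) * (scaledGaussDeriv l k (x - l * u) : ℂ) := by
    rw [h, wconv]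
    push_cast
    field_simp
  rw [h1]
  unfold powGauss wconv
  rw [← integral_const_mul, ← integral_const_mul]
  congr 1
  ext u
  have h2 : (x - l * u) / l = x / l - u := by field_simp
  rw [scaledGaussDeriv, h2, absPow, absPow, abs_mul, abs_of_pos hl, Complex.ofReal_mul,
    Complex.mul_cpow_ofReal_nonneg hl.le (abs_nonneg _)]
  push_cast
  rw [pow_succ]
  field_simp

lemma exp_natCast_cpow_powFreq (i j : ℕ) :
    (Real.exp i : ℂ) ^ powFreq j = (Real.exp (i / 2) : ℂ) := by
  rw [Complex.cpow_def_of_ne_zero (by exact_mod_cast (Real.exp_pos _).ne'),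
    ← Complex.ofReal_log (Real.exp_pos _).le, Real.log_exp, powFreq]
  have h : ((i : ℝ) : ℂ) * (1 / 2 + j * (2 * π * Complex.I)) =
      ((i / 2 : ℝ) : ℂ) + (i * j : ℕ) * (2 * π * Complex.I) := by
    push_cast
    ring
  rw [h, Complex.exp_add, Complex.exp_nat_mul_two_pi_mul_I, mul_one, Complex.ofReal_exp]

lemma convScaled1_ricker_eq {w : ℝ → ℂ} (hw : QuadGrowth w) {σ : ℝ} (hσ : 0 < σ) (x : ℝ) :
    convScaled1 (fun y => (w y).re) ricker σ x =
      σ ^ 2 * (wconv w (scaledGaussDeriv σ 2) x).re := by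
  have hi := wconv_integrable hw (quartDecay_scaledGaussDeriv hσ 2) x
  have h : (wconv w (scaledGaussDeriv σ 2) x).re =
      ∫ y, (w y * (scaledGaussDeriv σ 2 (x - y) : ℂ)).re := (integral_re hi).symm
  rw [h, ← integral_const_mul, convScaled1]
  congr 1
  ext y
  rw [Complex.re_mul_ofReal, scaledGaussDeriv, ricker_eq_gaussDeriv]
  have e : σ ^ 2 * σ⁻¹ ^ (2 + 1) = σ⁻¹ := by
    rw [inv_pow]
    field_simp
  linear_combination (-(w y).re * gaussDeriv 2 ((x - y) / σ)) * e

lemma quadGrowth_powGaussSum {m : ℕ} (d : Fin m → ℂ) (k : ℕ) : QuadGrowth (powGaussSum d k) := by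
  refine ⟨continuous_powGaussSum d k, ?_⟩
  choose C hC using fun j : Fin m => (quadGrowth_powGauss (powFreq_re j) k).2
  refine ⟨∑ j, ‖d j‖ * C j, fun x => (norm_sum_le _ _).trans ?_⟩
  rw [Finset.sum_mul]
  refine Finset.sum_le_sum fun j _ => ?_
  rw [norm_mul, mul_assoc]
  gcongr
  exact hC j x

lemma wconv_powGaussSum {m : ℕ} (d : Fin m → ℂ) (k : ℕ) {g : ℝ → ℝ} (hg : QuartDecay g) (x : ℝ) :
    wconv (powGaussSum d k) g x = ∑ j, d j * wconv (powGauss (powFreq j) k) g x := by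
  unfold wconv powGaussSum
  simp_rw [Finset.sum_mul, mul_assoc]
  rw [integral_finsetSum _ fun (j : Fin m) _ =>
    (wconv_integrable (quadGrowth_powGauss (powFreq_re j) k) hg x).const_mul (d j)]
  simp_rw [integral_const_mul]

/-- At scales with `√(1 + σ ^ 2) = e ^ i`, the wavelet transform of `powGaussSum d k` is a positive
multiple of a dilation of `powGaussSum d (k + 2)`. -/
lemma convScaled1_powGaussSum {m : ℕ} (d : Fin m → ℂ) (k : ℕ) {σ : ℝ} (hσ : 0 < σ) {i : ℕ}
    (hi : √(1 + σ ^ 2) = Real.exp i) (x : ℝ) :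
    convScaled1 (fun y => (powGaussSum d k y).re) ricker σ x =
      σ ^ 2 * (Real.exp (i / 2) * (Real.exp i)⁻¹ ^ (k + 2)) *
        (powGaussSum d (k + 2) (x / Real.exp i)).re := by
  have h : wconv (powGaussSum d k) (scaledGaussDeriv σ 2) x =
      ((Real.exp (i / 2) * (Real.exp i)⁻¹ ^ (k + 2) : ℝ) : ℂ) *
        powGaussSum d (k + 2) (x / Real.exp i) := by
    rw [wconv_powGaussSum d k (quartDecay_scaledGaussDeriv hσ 2), powGaussSum, Finset.mul_sum]
    refine Finset.sum_congr rfl fun j _ => ?_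
    rw [wconv_powGauss_scaledGaussDeriv (powFreq_re j) hσ, hi,
      wconv_absPow_scaledGaussDeriv _ (Real.exp_pos _), exp_natCast_cpow_powFreq]
    push_cast
    ring
  rw [convScaled1_ricker_eq (quadGrowth_powGaussSum d k) hσ, h, Complex.re_ofReal_mul,
    ← mul_assoc]

/-- **Marr conjecture in one dimension, part (c)**: unique determination fails for
functions of merely algebraic decay.  For every `n` there are integrable functions `f, g`
with finite moments through order `n`, neither a.e. a constant multiple of the other,
whose Ricker wavelet transforms have identical zero sets along a strictly increasing
sequence of scales tending to infinity. -/
theorem marr_one_dim_c (n : ℕ) :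
    ∃ (f g : ℝ → ℝ) (σ : ℕ → ℝ),
      Integrable f ∧ Integrable g ∧
      Integrable (fun x : ℝ => (1 + |x|) ^ n * (|f x| + |g x|)) ∧
      (¬ ∃ c : ℝ, ∀ᵐ x : ℝ, f x = c * g x) ∧
      (¬ ∃ c : ℝ, ∀ᵐ x : ℝ, g x = c * f x) ∧
      StrictMono σ ∧ (∀ i, 0 < σ i) ∧ Tendsto σ atTop atTop ∧
      ∀ i, {x : ℝ | convScaled1 f ricker (σ i) x = 0} =
        {x : ℝ | convScaled1 g ricker (σ i) x = 0} := by
  obtain ⟨m, c, ⟨C, hC⟩, hnot⟩ := exists_powGaussSum_dominated (n + 2) (n + 4)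
  have hs : (1 / 2 : ℂ).re = 1 / 2 := by norm_num
  have hC0 : 0 ≤ C := by
    obtain ⟨y, hy⟩ := exists_powGauss_ne_zero hs (n + 4)
    have h1 := (norm_nonneg _).trans (hC y)
    exact nonneg_of_mul_nonneg_left h1 (norm_pos_iff.2 hy)
  set ε : ℝ := (C + 1)⁻¹
  have hε : 0 < ε := by positivity
  have hεC : ε * C < 1 := by
    rw [← div_eq_inv_mul, div_lt_one (by linarith)]
    linarith
  let d : Fin (m + 1) → ℂ := Pi.single 0 1
  let e : Fin (m + 1) → ℂ := d + (ε : ℂ) • c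
  have hd : ∀ k y, powGaussSum d k y = powGauss (1 / 2) k y := powGaussSum_single
  have he : ∀ k y, (powGaussSum e k y).re =
      (powGauss (1 / 2) k y).re + ε * (powGaussSum c k y).re := fun k y => by
    rw [powGaussSum_add, powGaussSum_smul, hd, Complex.add_re, Complex.re_ofReal_mul]
  have hcont : ∀ a : Fin (m + 1) → ℂ, Continuous fun y => (powGaussSum a (n + 2) y).re :=
    fun a => Complex.continuous_re.comp (continuous_powGaussSum a (n + 2))
  have hmom : ∀ a : Fin (m + 1) → ℂ,
      Integrable fun y : ℝ => (1 + |y|) ^ n * |(powGaussSum a (n + 2) y).re| := fun a => by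
    refine (integrable_moment_powGaussSum a n).mono'
      (Continuous.aestronglyMeasurable (by have := hcont a; fun_prop)) (ae_of_all _ fun y => ?_)
    rw [Real.norm_of_nonneg (by positivity)]
    gcongr
    exact Complex.abs_re_le_norm _
  have hint : ∀ a : Fin (m + 1) → ℂ, Integrable fun y : ℝ => (powGaussSum a (n + 2) y).re :=
    fun a => by
    refine (hmom a).mono' (hcont a).aestronglyMeasurable (ae_of_all _ fun y => ?_)
    exact le_mul_of_one_le_left (abs_nonneg _) (one_le_pow₀ (by linarith [abs_nonneg y]))
  have hzero : ∀ y, (powGaussSum d (n + 4) y).re = 0 ↔ (powGaussSum e (n + 4) y).re = 0 := by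
    intro y
    have h1 := (Complex.abs_re_le_norm _).trans (hC y)
    rw [powGauss_half_eq_re, Complex.norm_real, Real.norm_eq_abs] at h1
    rw [hd, he]
    constructor
    · intro h
      rw [h, abs_zero, mul_zero] at h1
      rw [h, abs_nonpos_iff.1 h1, mul_zero, add_zero]
    · intro h
      by_contra hne
      have h2 := abs_pos.2 hne
      have h3 : |(powGauss (1 / 2) (n + 4) y).re| = ε * |(powGaussSum c (n + 4) y).re| := by
        rw [eq_neg_of_add_eq_zero_left h, abs_neg, abs_mul, abs_of_pos hε]
      nlinarith [mul_le_mul_of_nonneg_left h1 hε.le]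
  have hsq : ∀ i : ℕ, 0 < Real.exp (i + 1 : ℕ) ^ 2 - 1 := fun i => by
    have := Real.add_one_lt_exp (x := ((i + 1 : ℕ) : ℝ)) (by positivity)
    push_cast at this ⊢
    nlinarith [(Nat.cast_nonneg i : (0 : ℝ) ≤ i)]
  have hσ : ∀ i : ℕ, 0 < √(Real.exp (i + 1 : ℕ) ^ 2 - 1) := fun i => Real.sqrt_pos.2 (hsq i)
  have hl : ∀ i : ℕ, √(1 + √(Real.exp (i + 1 : ℕ) ^ 2 - 1) ^ 2) = Real.exp (i + 1 : ℕ) :=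
    fun i => by
    rw [Real.sq_sqrt (hsq i).le, add_sub_cancel, Real.sqrt_sq (Real.exp_pos _).le]
  refine ⟨fun y => (powGaussSum d (n + 2) y).re, fun y => (powGaussSum e (n + 2) y).re,
    fun i => √(Real.exp (i + 1 : ℕ) ^ 2 - 1), hint d, hint e, ?_, ?_, ?_, ?_, hσ, ?_, ?_⟩
  · simp only [mul_add]
    exact (hmom d).add (hmom e)
  · rintro ⟨a, ha⟩
    have ha' := congrFun ((Continuous.ae_eq_iff_eq volume (hcont d)
      (continuous_const.mul (hcont e))).1 ha)
    simp only [hd, he, Pi.mul_apply] at ha'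
    by_cases ha0 : a = 0
    · obtain ⟨y, hy⟩ := exists_powGauss_ne_zero hs (n + 2)
      refine hy ?_
      rw [powGauss_half_eq_re, ha' y, ha0, zero_mul, Complex.ofReal_zero]
    · refine hnot ⟨(1 - a) / (a * ε), fun y => ?_⟩
      have := ha' y
      field_simp
      linarith
  · rintro ⟨a, ha⟩
    have ha' := congrFun ((Continuous.ae_eq_iff_eq volume (hcont e)
      (continuous_const.mul (hcont d))).1 ha)
    simp only [hd, he, Pi.mul_apply] at ha'
    refine hnot ⟨(a - 1) / ε, fun y => ?_⟩
    have := ha' y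
    field_simp
    linarith
  · intro i j hij
    refine Real.sqrt_lt_sqrt (hsq i).le ?_
    have : Real.exp (i + 1 : ℕ) < Real.exp (j + 1 : ℕ) := by
      rw [Real.exp_lt_exp]
      exact_mod_cast Nat.succ_lt_succ hij
    gcongr
  · refine tendsto_atTop_mono (f := fun i : ℕ => (i : ℝ)) (fun i => ?_) tendsto_natCast_atTop_atTop
    refine Real.le_sqrt_of_sq_le ?_
    have := Real.add_one_le_exp ((i + 1 : ℕ) : ℝ)
    push_cast at this ⊢
    nlinarith [(Nat.cast_nonneg i : (0 : ℝ) ≤ i)]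
  · intro i
    ext x
    have hpos : √(Real.exp (i + 1 : ℕ) ^ 2 - 1) ^ 2 *
        (Real.exp ((i + 1 : ℕ) / 2) * (Real.exp (i + 1 : ℕ))⁻¹ ^ (n + 2 + 2)) ≠ 0 := by
      have := hσ i
      positivity
    rw [Set.mem_ofPred_eq, Set.mem_ofPred_eq, convScaled1_powGaussSum d (n + 2) (hσ i) (hl i),
      convScaled1_powGaussSum e (n + 2) (hσ i) (hl i), mul_eq_zero_iff_left hpos,
      mul_eq_zero_iff_left hpos]
    exact hzero _
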